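/- arXiv:1104.2232 — 3 statements merged into one kernel-verified Lean document; each statement's English description precedes it below -/
import Mathlib

section
/- Let A be a commutative ring and a = (a_0, a_1, a_2, …) ∈ W(A) a Witt vector such that a_0 is not a zero divisor in A. Then the map T_a : W(A) → W(A) is injective. If moreover a_0 is invertible in A, then T_a is bijective. -/
noncomputable section

namespace MRT

/-- `T_a(x) = Σ_{k ≥ 0} V^k([a_k]·x)`.  The `n`-th component of the infinite sum is the `n`-th
component of the partial sum `Σ_{k ≤ n} V^k([a_k]·x)`, which is independent of further terms. -/
def Tmap {p : ℕ} [Fact p.Prime] {A : Type} [CommRing A] (a x : WittVector p A) :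
    WittVector p A :=
  WittVector.mk p fun n =>
    (∑ i ∈ Finset.range (n + 1),
        (fun y : WittVector p A => WittVector.verschiebung y)^[i]
          (WittVector.teichmuller p (a.coeff i) * x)).coeff n

open WittVector

variable {p : ℕ} [Fact p.Prime] {A : Type} [CommRing A]

theorem trunc_eq_iff (n : ℕ) (x y : WittVector p A) :
    truncate n x = truncate n y ↔ ∀ i < n, x.coeff i = y.coeff i := by
  constructor
  · intro h i hi
    have := congrArg (TruncatedWittVector.coeff (⟨i, hi⟩ : Fin n)) h
    simpa using this
  · intro h
    ext i
    simpa using h i i.2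

theorem ext_trunc (x y : WittVector p A) (h : ∀ n, truncate n x = truncate n y) : x = y := by
  ext n
  exact (trunc_eq_iff (n + 1) x y).1 (h _) n (Nat.lt_succ_self n)

/-- partial sums -/
def Spart (a : WittVector p A) (m : ℕ) (x : WittVector p A) : WittVector p A :=
  ∑ i ∈ Finset.range m, (verschiebung)^[i] (teichmuller p (a.coeff i) * x)

theorem iter_add (i : ℕ) (x y : WittVector p A) :
    (verschiebung)^[i] (x + y) = (verschiebung)^[i] x + (verschiebung)^[i] y := by
  induction i with
  | zero => rfl
  | succ i ih => simp only [Function.iterate_succ_apply', ih, map_add]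

theorem Spart_add (a : WittVector p A) (m : ℕ) (x y : WittVector p A) :
    Spart a m (x + y) = Spart a m x + Spart a m y := by
  simp only [Spart, mul_add, iter_add, Finset.sum_add_distrib]

theorem trunc_iter_zero (n k : ℕ) (h : n ≤ k) (x : WittVector p A) :
    truncate n ((verschiebung)^[k] x) = 0 := by
  rw [← map_zero (truncate (p := p) (R := A) n), trunc_eq_iff]
  intro i hi
  rw [iterate_verschiebung_coeff_eq_zero x (by omega), zero_coeff]

theorem trunc_Spart (a x : WittVector p A) (n m : ℕ) (h : n ≤ m) :
    truncate n (Spart a m x) = truncate n (Spart a n x) := by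
  induction m, h using Nat.le_induction with
  | base => rfl
  | succ m h ih =>
    rw [← ih, Spart, Finset.sum_range_succ, map_add, trunc_iter_zero n m h, add_zero]
    rfl

theorem trunc_Tmap (a x : WittVector p A) (n : ℕ) :
    truncate n (Tmap a x) = truncate n (Spart a n x) := by
  rw [trunc_eq_iff]
  intro i hi
  have h := (trunc_eq_iff (i + 1) _ _).1 (trunc_Spart a x (i + 1) n hi) i (Nat.lt_succ_self i)
  rw [h]
  rfl

theorem Tmap_add (a x y : WittVector p A) : Tmap a (x + y) = Tmap a x + Tmap a y := by
  apply ext_trunc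
  intro n
  simp only [trunc_Tmap, map_add, Spart_add]

theorem ghost_zero_iter_frob (n k : ℕ) (x : WittVector p A) :
    ghostComponent k ((frobenius)^[n] x) = ghostComponent (k + n) x := by
  induction n generalizing k with
  | zero => rfl
  | succ n ih =>
    rw [Function.iterate_succ_apply', ghostComponent_frobenius, ih,
      show k + 1 + n = k + (n + 1) by omega]

theorem coeff_zero_eq_ghost (x : WittVector p A) : x.coeff 0 = ghostComponent 0 x := by
  simp [ghostComponent_apply]

theorem trunc_succ_Tmap_iter (a y : WittVector p A) (n : ℕ) :
    truncate (n + 1) (Tmap a ((verschiebung)^[n] y)) =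
      truncate (n + 1) ((verschiebung)^[n] ((frobenius)^[n] (teichmuller p (a.coeff 0)) * y)) := by
  rw [trunc_Tmap, Spart, Finset.sum_range_succ', map_add, map_sum, Finset.sum_eq_zero, zero_add]
  · rw [Function.iterate_zero_apply, mul_comm, iterate_verschiebung_mul_left, mul_comm]
  · intro i _
    rw [mul_comm, iterate_verschiebung_mul_left, ← Function.iterate_add_apply]
    exact trunc_iter_zero _ _ (by omega) _

theorem coeff_Tmap_iter (a y : WittVector p A) (n : ℕ) :
    (Tmap a ((verschiebung)^[n] y)).coeff n = a.coeff 0 ^ p ^ n * y.coeff 0 := by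
  rw [(trunc_eq_iff _ _ _).1 (trunc_succ_Tmap_iter a y n) n (Nat.lt_succ_self n)]
  have := iterate_verschiebung_coeff ((frobenius)^[n] (teichmuller p (a.coeff 0)) * y) n 0
  rw [zero_add] at this
  rw [this, mul_coeff_zero, coeff_zero_eq_ghost ((frobenius)^[n] _), ghost_zero_iter_frob,
    zero_add, ghostComponent_teichmuller]

theorem trunc_Tmap_iter (a y : WittVector p A) (n : ℕ) :
    truncate n (Tmap a ((verschiebung)^[n] y)) = 0 := by
  rw [← trunc_iter_zero n n le_rfl ((frobenius)^[n] (teichmuller p (a.coeff 0)) * y), trunc_eq_iff]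
  intro i hi
  exact (trunc_eq_iff _ _ _).1 (trunc_succ_Tmap_iter a y n) i (by omega)

theorem Tmap_step (a y : WittVector p A) (hu : IsUnit (a.coeff 0)) (n : ℕ) (x : WittVector p A)
    (h : truncate n (Tmap a x) = truncate n y) :
    ∃ x', truncate n x' = truncate n x ∧ truncate (n + 1) (Tmap a x') = truncate (n + 1) y := by
  obtain ⟨c, hc⟩ := ((hu.pow (p ^ n)).dvd : _ ∣ (y - Tmap a x).coeff n)
  refine ⟨x + (verschiebung)^[n] (teichmuller p c), ?_, ?_⟩
  · rw [map_add, trunc_iter_zero n n le_rfl, add_zero]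
  · have : truncate (n + 1) (Tmap a ((verschiebung)^[n] (teichmuller p c))) =
        truncate (n + 1) (y - Tmap a x) := by
      rw [trunc_eq_iff]
      intro i hi
      rcases Nat.lt_succ_iff_lt_or_eq.1 hi with hi | rfl
      · refine (trunc_eq_iff n _ _).1 ?_ i hi
        rw [trunc_Tmap_iter, map_sub, h, sub_self]
      · rw [coeff_Tmap_iter, hc, teichmuller_coeff_zero]
    rw [Tmap_add, map_add, this, map_sub, add_sub_cancel]

theorem Tmap_inj (a : WittVector p A) (ha : a.coeff 0 ∈ nonZeroDivisors A) :
    Function.Injective (fun x : WittVector p A => Tmap a x) := by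
  let T : WittVector p A →+ WittVector p A := AddMonoidHom.mk' (Tmap a) (Tmap_add a)
  change Function.Injective T
  rw [injective_iff_map_eq_zero]
  intro x hx
  ext n
  rw [zero_coeff]
  induction n using Nat.strong_induction_on with
  | _ n ih =>
    have h : x = (verschiebung)^[n] (x.shift n) := eq_iterate_verschiebung ih
    have hx' : Tmap a x = 0 := hx
    rw [h] at hx'
    have h2 := coeff_Tmap_iter a (x.shift n) n
    rw [hx', zero_coeff, shift_coeff, add_zero] at h2
    have h3 := pow_mem ha (p ^ n)
    rw [mul_comm] at h2
    exact (mem_nonZeroDivisors_iff.1 h3).2 _ h2.symm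

theorem Tmap_surj (a : WittVector p A) (hu : IsUnit (a.coeff 0)) :
    Function.Surjective (fun x : WittVector p A => Tmap a x) := by
  intro y
  choose f hf1 hf2 using Tmap_step a y hu
  let s : ∀ n, {x : WittVector p A // truncate n (Tmap a x) = truncate n y} := fun n =>
    Nat.rec ⟨0, (trunc_eq_iff 0 _ _).2 (by simp)⟩ (fun n x => ⟨f n x.1 x.2, hf2 n x.1 x.2⟩) n
  have hs : ∀ n, truncate n (s (n + 1)).1 = truncate n (s n).1 := fun n =>
    hf1 n (s n).1 (s n).2
  have hs' : ∀ i m, i < m → (s m).1.coeff i = (s (i + 1)).1.coeff i := by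
    intro i m h
    induction m, (show i + 1 ≤ m from h) using Nat.le_induction with
    | base => rfl
    | succ m h ih =>
      rw [(trunc_eq_iff _ _ _).1 (hs m) i (by omega), ih (by omega)]
  refine ⟨WittVector.mk p fun n => (s (n + 1)).1.coeff n, ?_⟩
  apply ext_trunc
  intro n
  have h1 : truncate n (WittVector.mk p fun n => (s (n + 1)).1.coeff n) = truncate n (s n).1 := by
    rw [trunc_eq_iff]
    intro i hi
    rw [coeff_mk, hs' i n hi]
  set x := WittVector.mk p fun n => (s (n + 1)).1.coeff n
  have h2 : ∀ i < n, (x - (s n).1).coeff i = 0 := by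
    rw [← mem_ker_truncate, RingHom.mem_ker, map_sub, h1, sub_self]
  have h3 := eq_iterate_verschiebung h2
  have h4 : x = (s n).1 + (verschiebung)^[n] ((x - (s n).1).shift n) := by
    rw [← h3]; ring
  change truncate n (Tmap a x) = _
  rw [h4, Tmap_add, map_add, trunc_Tmap_iter, add_zero, (s n).2]

/-- If `a_0` is not a zero divisor then `T_a` is injective; if `a_0` is
invertible then `T_a` is bijective. -/
theorem statement_15 (p : ℕ) [Fact p.Prime] (A : Type) [CommRing A] (a : WittVector p A)
    (ha : a.coeff 0 ∈ nonZeroDivisors A) :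
    Function.Injective (fun x : WittVector p A => Tmap a x) ∧
    (IsUnit (a.coeff 0) → Function.Bijective (fun x : WittVector p A => Tmap a x)) := by
  exact ⟨Tmap_inj a ha, fun hu => ⟨Tmap_inj a ha, Tmap_surj a hu⟩⟩

end MRT
end
end

section
/- Let A be a commutative ring and x = (x_0, x_1, x_2, …) ∈ W(A) a Witt vector such that x_0 is not a zero divisor in A. Then the map W(A) → W(A), a ↦ T_a(x), is injective. If moreover x_0 is invertible in A, then this map is bijective. -/
noncomputable section

namespace MRT

theorem add_iterate_coeff {p : ℕ} [Fact p.Prime] {A : Type} [CommRing A]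
    (S z : WittVector p A) (n : ℕ) :
    (S + (fun y : WittVector p A => WittVector.verschiebung y)^[n] z).coeff n
      = S.coeff n + z.coeff 0 := by
  have ht : ∀ i < n, (WittVector.tail n S).coeff i = 0 := by
    intro i hi
    simp [WittVector.tail, WittVector.select, hi]
  have hi0 : ∀ i, n ≤ i → (WittVector.init n S).coeff i = 0 := by
    intro i hi
    simp [WittVector.init, WittVector.select, hi]
  have htn : (WittVector.tail n S).coeff n = S.coeff n := by
    simp [WittVector.tail, WittVector.select]
  have hw := WittVector.eq_iterate_verschiebung ht
  set w := (WittVector.tail n S).shift n with hwdef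
  have hw0 : w.coeff 0 = S.coeff n := by
    rw [hwdef, WittVector.shift_coeff, add_zero, htn]
  have hadd : WittVector.verschiebung^[n] w + WittVector.verschiebung^[n] z
      = WittVector.verschiebung^[n] (w + z) := by
    rw [iterate_map_add]
  have hS : S + WittVector.verschiebung^[n] z
      = WittVector.init n S + WittVector.verschiebung^[n] (w + z) := by
    rw [← hadd, ← hw, ← add_assoc, WittVector.init_add_tail]
  change (S + WittVector.verschiebung^[n] z).coeff n = _
  have hc := WittVector.iterate_verschiebung_coeff (w + z) n 0
  rw [zero_add] at hc
  rw [hS, WittVector.coeff_add_of_disjoint, hi0 n le_rfl, hc, zero_add,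
    WittVector.add_coeff_zero, hw0]
  intro m
  rcases lt_or_ge m n with h | h
  · right
    exact WittVector.iterate_verschiebung_coeff_eq_zero _ h
  · left
    exact hi0 m h

theorem Tmap_coeff {p : ℕ} [Fact p.Prime] {A : Type} [CommRing A]
    (a x : WittVector p A) (n : ℕ) :
    (Tmap a x).coeff n = (∑ i ∈ Finset.range n,
        (fun y : WittVector p A => WittVector.verschiebung y)^[i]
          (WittVector.teichmuller p (a.coeff i) * x)).coeff n + a.coeff n * x.coeff 0 := by
  rw [Tmap, WittVector.coeff_mk, Finset.sum_range_succ, add_iterate_coeff,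
    WittVector.mul_coeff_zero, WittVector.teichmuller_coeff_zero]

/-- Recursive construction of the preimage. -/
def preim {p : ℕ} [Fact p.Prime] {A : Type} [CommRing A]
    (x y : WittVector p A) (u : A) : ℕ → A
  | n => (y.coeff n - (∑ i : Fin n,
        (fun y : WittVector p A => WittVector.verschiebung y)^[i.1]
          (WittVector.teichmuller p (preim x y u i.1) * x)).coeff n) * u
termination_by n => n
decreasing_by exact i.2

/-- If `x_0` is not a zero divisor then `a ↦ T_a(x)` is injective; if `x_0`
is invertible then it is bijective. -/
theorem statement_16 (p : ℕ) [Fact p.Prime] (A : Type) [CommRing A] (x : WittVector p A)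
    (hx : x.coeff 0 ∈ nonZeroDivisors A) :
    Function.Injective (fun a : WittVector p A => Tmap a x) ∧
    (IsUnit (x.coeff 0) → Function.Bijective (fun a : WittVector p A => Tmap a x)) := by
  have hinj : Function.Injective (fun a : WittVector p A => Tmap a x) := by
    intro a b hab
    ext n
    induction n using Nat.strong_induction_on with
    | _ n ih =>
      have h : (Tmap a x).coeff n = (Tmap b x).coeff n :=
        congrArg (fun t : WittVector p A => t.coeff n) hab
      rw [Tmap_coeff, Tmap_coeff] at h
      rw [Finset.sum_congr rfl (fun i hi => by rw [ih i (Finset.mem_range.mp hi)])] at h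
      exact (mul_cancel_right_mem_nonZeroDivisors hx).mp (add_left_cancel h)
  refine ⟨hinj, fun hu => ⟨hinj, fun y => ?_⟩⟩
  obtain ⟨u, hu⟩ := hu.exists_left_inv
  refine ⟨WittVector.mk p (preim x y u), ?_⟩
  ext n
  change (Tmap _ x).coeff n = _
  rw [Tmap_coeff]
  simp only [WittVector.coeff_mk]
  conv_lhs => arg 2; rw [preim]
  rw [mul_assoc, hu, mul_one, Finset.sum_range]
  ring

end MRT
end
end

section
/- Let p ≥ 3 be a prime and consider the element p of the ring W(ℤ) of p-typical Witt vectors over ℤ, with components (c_0, c_1, c_2, …). Then c_0 = p, c_1 = 1 − p^{p−1}, and for every i ≥ 2 one has p^{p−1} ∣ c_i in ℤ and c_i / p^{p−1} ≡ 1 (mod p); that is, p = (p, 1−p^{p−1}, ε_2 p^{p−1}, ε_3 p^{p−1}, …) in W(ℤ), where each ε_i is a principal p-adic unit. -/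
noncomputable section

namespace MRT

lemma pow_lift (p : ℕ) (hp3 : 3 ≤ p) (m : ℕ) :
    ∃ t : ℤ, (1 - (p : ℤ) ^ (p - 1)) ^ (p ^ m) = 1 - (p : ℤ) ^ (p - 1 + m) * (1 + p * t) := by
  induction m with
  | zero => exact ⟨0, by simp⟩
  | succ m ih =>
    obtain ⟨t, ht⟩ := ih
    rw [pow_succ, pow_mul, ht]
    obtain ⟨b, hb⟩ : ∃ b, p - 1 + m = b + 2 := ⟨p - 1 + m - 2, by omega⟩
    rw [← add_assoc, hb]
    set u : ℤ := 1 - (p : ℤ) ^ (b + 2) * (1 + p * t) with hu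
    have h1 : (p : ℤ) ^ 2 ∣ ∑ i ∈ Finset.range p, u ^ i - p := by
      have : ∑ i ∈ Finset.range p, u ^ i - (p : ℤ) = ∑ i ∈ Finset.range p, (u ^ i - 1) := by
        simp
      rw [this]
      refine Finset.dvd_sum fun i _ => ?_
      have h2 : u - 1 ∣ u ^ i - 1 := by simpa using sub_dvd_pow_sub_pow u 1 i
      refine Dvd.dvd.trans ⟨-((p : ℤ) ^ b * (1 + p * t)), ?_⟩ h2
      rw [hu]; ring
    obtain ⟨s, hs⟩ := h1
    refine ⟨t + s + p * t * s, ?_⟩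
    have h3 := geom_sum_mul u p
    have h4 : ∑ i ∈ Finset.range p, u ^ i = p + (p : ℤ) ^ 2 * s := by linarith
    rw [h4] at h3
    have h5 : u ^ p = 1 + (p + (p : ℤ) ^ 2 * s) * (u - 1) := by linarith
    rw [h5, hu]; ring

lemma ghost_eq (p : ℕ) [Fact p.Prime] (n : ℕ) :
    ∑ i ∈ Finset.range (n + 1),
      (p : ℤ) ^ i * ((p : WittVector p ℤ)).coeff i ^ (p ^ (n - i)) = p := by
  have h : WittVector.ghostComponent n (p : WittVector p ℤ) = (p : ℤ) := map_natCast _ _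
  rw [WittVector.ghostComponent_apply, aeval_wittPolynomial] at h
  simpa using h

/-- For `p ≥ 3`, in `W(ℤ)` one has
`p = (p, 1 - p^{p-1}, ε_2 p^{p-1}, ε_3 p^{p-1}, …)` with each `ε_i` a principal p-adic unit. -/
theorem statement_18 (p : ℕ) [Fact p.Prime] (hp3 : 3 ≤ p) :
    ((p : WittVector p ℤ)).coeff 0 = (p : ℤ) ∧
    ((p : WittVector p ℤ)).coeff 1 = 1 - (p : ℤ) ^ (p - 1) ∧
    (∀ i : ℕ, 2 ≤ i → ∃ ε : ℤ, ((p : WittVector p ℤ)).coeff i = ε * (p : ℤ) ^ (p - 1) ∧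
      ε ≡ 1 [ZMOD (p : ℤ)]) := by
  have hp0 : (p : ℤ) ≠ 0 := by positivity
  have hg := ghost_eq p
  generalize ((p : WittVector p ℤ)).coeff = c at hg ⊢
  have h0 : c 0 = p := by simpa using hg 0
  have h1 : c 1 = 1 - (p : ℤ) ^ (p - 1) := by
    have h := hg 1
    simp only [Finset.sum_range_succ, Finset.sum_range_zero, h0] at h
    apply mul_left_cancel₀ hp0
    rw [mul_sub, ← pow_succ', show p - 1 + 1 = p by omega]
    simp at h
    linarith
  refine ⟨h0, h1, fun n => ?_⟩
  induction n using Nat.strong_induction_on with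
  | _ n ih =>
    intro hn
    obtain ⟨k, rfl⟩ : ∃ k, n = k + 2 := ⟨n - 2, by omega⟩
    have h := hg (k + 2)
    rw [Finset.sum_range_succ, Finset.sum_range_succ', Finset.sum_range_succ', h0] at h
    obtain ⟨t, ht⟩ := pow_lift p hp3 (k + 1)
    have hS : (p : ℤ) ^ (k + 2 + p) ∣ ∑ i ∈ Finset.range k,
        (p : ℤ) ^ (i + 1 + 1) * c (i + 1 + 1) ^ (p ^ (k + 2 - (i + 1 + 1))) := by
      refine Finset.dvd_sum fun i hi => ?_
      have hi := Finset.mem_range.mp hi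
      obtain ⟨ε, hε, -⟩ := ih (i + 2) (by omega) (by omega)
      obtain ⟨j, rfl⟩ : ∃ j, k = i + (j + 1) := ⟨k - i - 1, by omega⟩
      rw [show i + 1 + 1 = i + 2 by rfl, hε,
        show i + (j + 1) + 2 - (i + 2) = j + 1 by omega, mul_pow, ← pow_mul]
      have hle : i + (j + 1) + 2 + p ≤ (i + 2) + (p - 1) * p ^ (j + 1) := by
        have a1 : j + 1 < p ^ (j + 1) := Nat.lt_pow_self (by omega)
        have a2 : p ≤ p ^ (j + 1) := Nat.le_self_pow (by omega) p
        have a3 : 2 * p ^ (j + 1) ≤ (p - 1) * p ^ (j + 1) :=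
          Nat.mul_le_mul_right _ (by omega)
        omega
      refine (pow_dvd_pow (p : ℤ) hle).trans ⟨ε ^ p ^ (j + 1), ?_⟩
      rw [pow_add]; ring
    have h00 : (p : ℤ) ^ (k + 2 + p) ∣ (p : ℤ) ^ p ^ (k + 2) := by
      apply pow_dvd_pow
      have a1 : k + 1 < p ^ (k + 1) := Nat.lt_pow_self (by omega)
      have a2 : p ≤ p ^ (k + 1) := Nat.le_self_pow (by omega) p
      have a3 : p ^ (k + 1) * 3 ≤ p ^ (k + 2) := by
        rw [pow_succ p (k + 1)]; exact Nat.mul_le_mul_left _ hp3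
      omega
    obtain ⟨a, ha⟩ := hS
    obtain ⟨b, hb⟩ := h00
    rw [ha] at h
    simp only [zero_add, pow_zero, one_mul, Nat.sub_zero, Nat.sub_self, pow_one, h1,
      show k + 2 - 1 = k + 1 by omega, ht, hb] at h
    refine ⟨1 + p * (t - a - b), ?_, ?_⟩
    · apply mul_left_cancel₀ (pow_ne_zero (k + 2) hp0)
      obtain ⟨q, hq⟩ : ∃ q, p = q + 1 := ⟨p - 1, by omega⟩
      have e1 : (p : ℤ) ^ (k + 2 + p) = (p : ℤ) ^ (k + 2) * p ^ (p - 1) * p := by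
        rw [← pow_add, ← pow_succ]; congr 1; omega
      have e2 : (p : ℤ) * (p : ℤ) ^ (p - 1 + (k + 1)) = (p : ℤ) ^ (k + 2) * p ^ (p - 1) := by
        rw [← pow_add, ← pow_succ']; congr 1; omega
      rw [e1] at h
      linear_combination h + (1 + p * t) * e2
    · exact (Int.modEq_iff_dvd.mpr ⟨-(t - a - b), by ring⟩)

end MRT
end
end
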